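/- Let A be a real l×m matrix satisfying the RIP of order 3s with constant δ₃ₛ ∈ (0,1). Let h⋆, h ∈ ℝᵐ each have at most s nonzero entries, and let S be a set of s largest-magnitude indices of the vector h + Aᵀ A (h⋆ − h). Then the restriction of h⋆ to the complement of S satisfies ‖h⋆|_{Sᶜ}‖₂ ≤ √2 · δ₃ₛ · ‖h − h⋆‖₂. -/

import Mathlib

open Matrix
open scoped BigOperators

/-- The Euclidean (ℓ₂) norm of a vector in ℝⁿ. -/
noncomputable def l2norm {n : ℕ} (x : Fin n → ℝ) : ℝ := Real.sqrt (∑ i, (x i)^2)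

/-- A vector has at most `s` nonzero entries. -/
def IsSparse {m : ℕ} (s : ℕ) (x : Fin m → ℝ) : Prop :=
  (Finset.univ.filter fun i => x i ≠ 0).card ≤ s

/-- `A` satisfies the restricted isometry property of order `k` with constant `δ`. -/
def SatisfiesRIP {l m : ℕ} (A : Matrix (Fin l) (Fin m) ℝ) (k : ℕ) (δ : ℝ) : Prop :=
  ∀ x : Fin m → ℝ, IsSparse k x →
    (1 - δ) * (l2norm x)^2 ≤ (l2norm (A *ᵥ x))^2 ∧
      (l2norm (A *ᵥ x))^2 ≤ (1 + δ) * (l2norm x)^2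

/-- `S` is a set of `s` largest-magnitude indices of `h`. -/
def IsLargestIndices {m : ℕ} (s : ℕ) (h : Fin m → ℝ) (S : Finset (Fin m)) : Prop :=
  S.card = s ∧ ∀ i ∈ S, ∀ j ∉ S, |h j| ≤ |h i|

/-- The restriction of `v` to `S`: equal to `v` on `S` and zero outside `S`. -/
def restrictVec {m : ℕ} (S : Finset (Fin m)) (v : Fin m → ℝ) : Fin m → ℝ :=
  fun i => if i ∈ S then v i else 0

/-- `hhat` minimizes `‖y − A u‖₂` over all `u` with support contained in `S`. -/
def IsLSMinimizerOn {l m : ℕ} (A : Matrix (Fin l) (Fin m) ℝ) (y : Fin l → ℝ)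
    (S : Finset (Fin m)) (hhat : Fin m → ℝ) : Prop :=
  (∀ i, hhat i ≠ 0 → i ∈ S) ∧
  ∀ u : Fin m → ℝ, (∀ i, u i ≠ 0 → i ∈ S) →
    l2norm (y - A *ᵥ hhat) ≤ l2norm (y - A *ᵥ u)

theorem l2norm_sq_eq_dotProduct {n : ℕ} (x : Fin n → ℝ) : l2norm x ^ 2 = x ⬝ᵥ x := by
  rw [l2norm, Real.sq_sqrt (Finset.sum_nonneg fun i _ => sq_nonneg (x i))]
  exact Finset.sum_congr rfl fun i _ => sq (x i)

theorem isSparse_of_support_subset {m k : ℕ} {U : Finset (Fin m)} (hU : U.card ≤ k)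
    {x : Fin m → ℝ} (hx : ∀ i ∉ U, x i = 0) : IsSparse k x := by
  refine (Finset.card_le_card fun i hi => ?_).trans hU
  by_contra hiU
  exact (Finset.mem_filter.1 hi).2 (hx i hiU)

/-- A sum over a smaller set of smaller nonnegative values is smaller. -/
theorem Finset.sum_le_sum_of_card_le_of_forall_le {ι : Type*} {P Q : Finset ι} {f : ι → ℝ}
    (hf : ∀ i, 0 ≤ f i) (hcard : P.card ≤ Q.card) (hPQ : ∀ i ∈ P, ∀ j ∈ Q, f i ≤ f j) :
    ∑ i ∈ P, f i ≤ ∑ j ∈ Q, f j := by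
  rcases P.eq_empty_or_nonempty with rfl | hP
  · simpa using Finset.sum_nonneg fun j _ => hf j
  · obtain ⟨c, hc, hmax⟩ := P.exists_max_image f hP
    calc ∑ i ∈ P, f i ≤ P.card • f c := Finset.sum_le_card_nsmul _ _ _ hmax
      _ ≤ Q.card • f c := nsmul_le_nsmul_left (hf c) hcard
      _ ≤ ∑ j ∈ Q, f j := Finset.card_nsmul_le_sum _ _ _ fun j hj => hPQ c hc j hj

/-- Under the RIP, `I - Aᵀ A` restricted to a set `U` of at most `k` indices contracts by `δ`. -/
theorem SatisfiesRIP.sum_sq_sub_gram_le {l m k : ℕ} {A : Matrix (Fin l) (Fin m) ℝ} {δ : ℝ}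
    (hA : SatisfiesRIP A k δ) (hδ : 0 < δ) {U : Finset (Fin m)} (hU : U.card ≤ k)
    {d : Fin m → ℝ} (hd : ∀ i ∉ U, d i = 0) :
    ∑ i ∈ U, (d - Aᵀ *ᵥ (A *ᵥ d)) i ^ 2 ≤ δ ^ 2 * l2norm d ^ 2 := by
  set e := d - Aᵀ *ᵥ (A *ᵥ d) with he
  set w := restrictVec U e with hw
  have hw0 : ∀ i ∉ U, w i = 0 := fun i hi => by simp [hw, restrictVec, hi]
  have hsum : ∑ i ∈ U, e i ^ 2 = w ⬝ᵥ w := by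
    simp [dotProduct, hw, restrictVec, sq]
  have hew : e ⬝ᵥ w = w ⬝ᵥ w := by
    simp [dotProduct, hw, restrictVec]
  have hgram : e ⬝ᵥ w = d ⬝ᵥ w - (A *ᵥ d) ⬝ᵥ (A *ᵥ w) := by
    rw [he, sub_dotProduct, mulVec_transpose, ← dotProduct_mulVec]
  have hplus := (hA (δ • d + w) (isSparse_of_support_subset hU fun i hi => by
    simp [hd i hi, hw0 i hi])).1
  have hminus := (hA (δ • d - w) (isSparse_of_support_subset hU fun i hi => by
    simp [hd i hi, hw0 i hi])).2
  simp only [l2norm_sq_eq_dotProduct, mulVec_add, mulVec_sub, mulVec_smul, dotProduct_add,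
    add_dotProduct, dotProduct_sub, sub_dotProduct, smul_dotProduct, dotProduct_smul,
    smul_eq_mul, dotProduct_comm w d, dotProduct_comm (A *ᵥ w) (A *ᵥ d)] at hplus hminus
  rw [hsum, l2norm_sq_eq_dotProduct]
  have hcross : d ⬝ᵥ w = w ⬝ᵥ w + (A *ᵥ d) ⬝ᵥ (A *ᵥ w) := by linarith
  rw [hcross] at hplus hminus
  refine le_of_mul_le_mul_left ?_ hδ
  linarith

/-- Off-support bound for the greedy subset-selection step. -/
theorem offsupport_selection_bound
    (l m s : ℕ) (A : Matrix (Fin l) (Fin m) ℝ) (δ₃ : ℝ)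
    (hδ₃0 : 0 < δ₃) (hδ₃1 : δ₃ < 1)
    (hRIP3 : SatisfiesRIP A (3*s) δ₃)
    (hstar : Fin m → ℝ) (hstar_sparse : IsSparse s hstar)
    (h : Fin m → ℝ) (hh_sparse : IsSparse s h)
    (S : Finset (Fin m)) (hS : IsLargestIndices s (h + Aᵀ *ᵥ (A *ᵥ (hstar - h))) S) :
    l2norm (restrictVec Sᶜ hstar) ≤ Real.sqrt 2 * δ₃ * l2norm (h - hstar) := by
  set d := h - hstar with hd
  set e := d - Aᵀ *ᵥ (A *ᵥ d) with he
  set T := Finset.univ.filter fun i => hstar i ≠ 0 with hT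
  set H := Finset.univ.filter fun i => h i ≠ 0 with hH
  have hz : h + Aᵀ *ᵥ (A *ᵥ (hstar - h)) = hstar + e := by
    rw [he, hd, ← neg_sub h hstar, mulVec_neg, mulVec_neg]
    abel
  rw [hz] at hS
  obtain ⟨hScard, hSmax⟩ := hS
  have hTcard : T.card ≤ s := hstar_sparse
  have hHcard : H.card ≤ s := hh_sparse
  have hstar0 : ∀ i ∉ T, hstar i = 0 := fun i hi => by simpa [hT] using hi
  have hh0 : ∀ i ∉ H, h i = 0 := fun i hi => by simpa [hH] using hi
  have hUcard : (H ∪ (T ∪ S)).card ≤ 3 * s := by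
    have h₁ := Finset.card_union_le H (T ∪ S)
    have h₂ := Finset.card_union_le T S
    omega
  have hcontr := hRIP3.sum_sq_sub_gram_le hδ₃0 hUcard (d := d) fun i hi => by
    simp only [Finset.mem_union, not_or] at hi
    simp [hd, hh0 i hi.1, hstar0 i hi.2.1]
  have hselect : ∑ i ∈ T \ S, (hstar + e) i ^ 2 ≤ ∑ i ∈ S \ T, (hstar + e) i ^ 2 := by
    refine Finset.sum_le_sum_of_card_le_of_forall_le (fun i => sq_nonneg _) ?_
      fun i hi j hj => ?_
    · have h₁ := Finset.card_sdiff_add_card_inter T S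
      have h₂ := Finset.card_sdiff_add_card_inter S T
      rw [Finset.inter_comm] at h₂
      omega
    · exact sq_le_sq.2 (hSmax j (Finset.mem_sdiff.1 hj).1 i (Finset.mem_sdiff.1 hi).2)
  have hST : ∑ i ∈ S \ T, (hstar + e) i ^ 2 = ∑ i ∈ S \ T, e i ^ 2 :=
    Finset.sum_congr rfl fun i hi => by simp [hstar0 i (Finset.mem_sdiff.1 hi).2]
  have hunion : ∑ i ∈ T \ S, e i ^ 2 + ∑ i ∈ S \ T, e i ^ 2 ≤ ∑ i ∈ H ∪ (T ∪ S), e i ^ 2 := by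
    rw [← Finset.sum_union (disjoint_sdiff_sdiff)]
    refine Finset.sum_le_sum_of_subset_of_nonneg (fun i hi => ?_) fun i _ _ => sq_nonneg _
    simp only [Finset.mem_union, Finset.mem_sdiff] at hi ⊢
    tauto
  have htri : ∑ i ∈ T \ S, hstar i ^ 2
      ≤ 2 * ∑ i ∈ T \ S, (hstar + e) i ^ 2 + 2 * ∑ i ∈ T \ S, e i ^ 2 := by
    rw [Finset.mul_sum, Finset.mul_sum, ← Finset.sum_add_distrib]
    refine Finset.sum_le_sum fun i _ => ?_
    rw [Pi.add_apply]
    nlinarith [sq_nonneg (hstar i + 2 * e i)]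
  have hrestrict : ∑ i, restrictVec Sᶜ hstar i ^ 2 = ∑ i ∈ T \ S, hstar i ^ 2 := by
    symm
    refine Finset.sum_subset_zero_on_sdiff (Finset.subset_univ _) (fun i hi => ?_) fun i hi => ?_
    · by_cases hiS : i ∈ S
      · simp [restrictVec, hiS]
      · have hiT : i ∉ T := fun hiT => by simp [hiT, hiS] at hi
        simp [restrictVec, hstar0 i hiT]
    · simp [restrictVec, (Finset.mem_sdiff.1 hi).2]
  have hd0 : 0 ≤ l2norm d := Real.sqrt_nonneg _
  refine Real.sqrt_le_iff.2 ⟨by positivity, ?_⟩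
  rw [hrestrict, mul_pow, mul_pow, Real.sq_sqrt zero_le_two]
  linarith
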